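/- arXiv:2312.03688 — 2 statements merged into one kernel-verified Lean document; each statement's English description precedes it below -/
import Mathlib

section
/- Let q ≥ 2, and let a, b, r, r₁, …, r_a be positive integers with a ≥ b and r_i ≤ r for all i. Then the sparse twin-width of the graph Π(r₁,…,r_a; b, q) is at most r^{2b} · a^b · q^{ar − b(r−1) + 1}. -/
noncomputable section

namespace TwwPaper

open Finset

variable {V : Type*}

/-- The number of edges of `G` with both endpoints in `X`. -/
def edgesIn (G : SimpleGraph V) (X : Finset V) : ℕ :=
  Nat.card {e : Sym2 V // e ∈ G.edgeSet ∧ ∀ v ∈ e, v ∈ X}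

/-- The number of edges of `G`. -/
def edgeCount (G : SimpleGraph V) : ℕ := Nat.card G.edgeSet

/-- The maximum average degree of `G`: the maximum over nonempty vertex subsets `X`
of `2 e(G[X]) / |X|`. -/
def mad [Fintype V] (G : SimpleGraph V) : ℝ :=
  ⨆ X : {X : Finset V // X.Nonempty}, (2 * edgesIn G X.1 : ℝ) / X.1.card

/-- The degree of a vertex. -/
def deg (G : SimpleGraph V) (v : V) : ℕ := Nat.card (G.neighborSet v)

/-- The maximum degree `Δ(G)`. -/
def maxDeg [Fintype V] (G : SimpleGraph V) : ℕ := univ.sup (deg G)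

/-- `G` is `d`-regular. -/
def IsReg (G : SimpleGraph V) (d : ℕ) : Prop := ∀ v, deg G v = d

/-- `G` admits an orientation with maximum outdegree at most one:
an assignment of a tail (source) vertex to each edge, no vertex being
the tail of two distinct edges. -/
def HasOrientationOutdegLEOne (G : SimpleGraph V) : Prop :=
  ∃ f : G.edgeSet → V, (∀ e : G.edgeSet, f e ∈ (e : Sym2 V)) ∧ Function.Injective f

/-- Two lists (sequences) of the same length `r` are close if they contain a common
subsequence of length `r - 1`, obtained by deleting one entry from each. -/
def Close {S : Type*} (L M : List S) : Prop :=
  ∃ i < L.length, ∃ j < M.length, L.eraseIdx i = M.eraseIdx j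

section Partitions

variable [Fintype V] [DecidableEq V]

/-- `Q` is obtained from `P` by merging the two distinct parts `A` and `B`. -/
def IsMergeStep (P Q : Finpartition (univ : Finset V)) : Prop :=
  ∃ A ∈ P.parts, ∃ B ∈ P.parts, A ≠ B ∧
    Q.parts = insert (A ∪ B) ((P.parts.erase A).erase B)

/-- Degree of the part `A` in the quotient graph `G / P`. -/
def quotDeg (G : SimpleGraph V) (P : Finpartition (univ : Finset V)) (A : Finset V) : ℕ :=
  Nat.card {B : Finset V // B ∈ P.parts ∧ B ≠ A ∧ ∃ u ∈ A, ∃ v ∈ B, G.Adj u v}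

/-- Red degree of the part `A` with respect to the partition `P`: the number of other
parts `B` which are neither fully adjacent nor fully non-adjacent to `A`. -/
def redDeg (G : SimpleGraph V) (P : Finpartition (univ : Finset V)) (A : Finset V) : ℕ :=
  Nat.card {B : Finset V // B ∈ P.parts ∧ B ≠ A ∧ (∃ u ∈ A, ∃ v ∈ B, G.Adj u v) ∧
    ¬ (∀ u ∈ A, ∀ v ∈ B, G.Adj u v)}

/-- There is a sequence of partitions of `V(G)`, starting at the discrete partition,
ending with at most one part, each obtained from the previous one by merging two parts,
such that every part of every intermediate partition has `degFn`-degree at most `w`. -/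
def SeqOK (G : SimpleGraph V)
    (degFn : SimpleGraph V → Finpartition (univ : Finset V) → Finset V → ℕ) (w : ℕ) : Prop :=
  ∃ n : ℕ, ∃ P : Fin (n + 1) → Finpartition (univ : Finset V),
    (∀ A ∈ (P 0).parts, A.card = 1) ∧
    (P (Fin.last n)).parts.card ≤ 1 ∧
    (∀ i : Fin n, IsMergeStep (P i.castSucc) (P i.succ)) ∧
    (∀ i, ∀ A ∈ (P i).parts, degFn G (P i) A ≤ w)

/-- The sparse twin-width of `G`: the least `w` such that `G` can be contracted to a
single vertex by iterated pairwise identifications with all intermediate (quotient)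
graphs of maximum degree at most `w`. -/
def stww (G : SimpleGraph V) : ℕ := sInf {w | SeqOK G quotDeg w}

/-- The twin-width of `G`, via contraction sequences minimizing the maximum red degree. -/
def tww (G : SimpleGraph V) : ℕ := sInf {w | SeqOK G redDeg w}

/-- The quotient graph `G / P`: parts of `P` are adjacent iff some edge of `G` joins them. -/
def quotGraph (G : SimpleGraph V) (P : Finpartition (univ : Finset V)) :
    SimpleGraph {A : Finset V // A ∈ P.parts} :=
  SimpleGraph.fromRel (fun A B => ∃ u ∈ A.1, ∃ v ∈ B.1, G.Adj u v)

end Partitions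

/-- A graph is `w`-degenerate if every nonempty (induced) subgraph has a vertex of
degree at most `w` in it. -/
def Degenerate {W : Type*} (w : ℕ) (H : SimpleGraph W) : Prop :=
  ∀ s : Finset W, s.Nonempty → ∃ a ∈ s, Nat.card {b : W // b ∈ s ∧ H.Adj a b} ≤ w

/-- The graph `Π(r₁,…,r_a; b, q)`: vertices are tuples `(v₁,…,v_a)` with `vᵢ ∈ [q]^{rᵢ}`,
two tuples being adjacent iff (they are distinct and) at least `b` coordinates are
pairwise equal or close. -/
def PiGraph (a b q : ℕ) (rfn : Fin a → ℕ) : SimpleGraph (∀ i : Fin a, Fin (rfn i) → Fin q) :=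
  SimpleGraph.fromRel (fun u v => ∃ I : Finset (Fin a), I.card = b ∧
    ∀ i ∈ I, u i = v i ∨ Close (List.ofFn (u i)) (List.ofFn (v i)))

section Contraction

variable [Fintype V] [DecidableEq V] {W W' : Type*}

/-- Every part of `P` lies in a fibre of `g`. -/
def RefinesFibers (P : Finpartition (univ : Finset V)) (g : V → W) : Prop :=
  ∀ A ∈ P.parts, ∀ x ∈ A, ∀ y ∈ A, g x = g y

/-- Every part of `P` is a union of fibres of `f`. -/
def FiberSaturated (P : Finpartition (univ : Finset V)) (f : V → W) : Prop :=
  ∀ A ∈ P.parts, ∀ x ∈ A, ∀ y, f x = f y → y ∈ A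

/-- One contraction step whose result has all quotient degrees at most `w`. -/
def BoundedMerge (G : SimpleGraph V) (w : ℕ) (P Q : Finpartition (univ : Finset V)) : Prop :=
  IsMergeStep P Q ∧ ∀ A ∈ Q.parts, quotDeg G Q A ≤ w

lemma exists_merge (P : Finpartition (univ : Finset V)) {A B : Finset V}
    (hA : A ∈ P.parts) (hB : B ∈ P.parts) (hAB : A ≠ B) :
    ∃ Q : Finpartition (univ : Finset V),
      Q.parts = insert (A ∪ B) ((P.parts.erase A).erase B) := by
  refine ⟨Finpartition.ofExistsUnique (insert (A ∪ B) ((P.parts.erase A).erase B))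
    (fun _ _ => subset_univ _) ?_ ?_, rfl⟩
  · intro x _
    obtain ⟨C, ⟨hC, hxC⟩, hu⟩ := P.existsUnique_mem (mem_univ x)
    by_cases hx : x ∈ A ∪ B
    · refine ⟨A ∪ B, ⟨mem_insert_self _ _, hx⟩, ?_⟩
      rintro D ⟨hD, hxD⟩
      rcases mem_insert.1 hD with rfl | hD
      · rfl
      · simp only [mem_erase] at hD
        obtain ⟨hDB, hDA, hD⟩ := hD
        have hDC := hu D ⟨hD, hxD⟩
        rcases mem_union.1 hx with hx | hx
        · exact absurd (hDC.trans (hu A ⟨hA, hx⟩).symm) hDA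
        · exact absurd (hDC.trans (hu B ⟨hB, hx⟩).symm) hDB
    · have hCA : C ≠ A := by rintro rfl; exact hx (mem_union_left _ hxC)
      have hCB : C ≠ B := by rintro rfl; exact hx (mem_union_right _ hxC)
      refine ⟨C, ⟨by simp [hCA, hCB, hC], hxC⟩, ?_⟩
      rintro D ⟨hD, hxD⟩
      rcases mem_insert.1 hD with rfl | hD
      · exact absurd hxD hx
      · simp only [mem_erase] at hD
        exact hu D ⟨hD.2.2, hxD⟩
  · intro h
    rcases mem_insert.1 h with h | h
    · exact (P.nonempty_of_mem_parts hA).ne_empty (union_eq_empty.1 h.symm).1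
    · simp only [mem_erase] at h
      exact P.empty_notMem_parts h.2.2

/-- Parts of an intermediate partition can be merged, one pair at a time, until they are
exactly the fibres of `g`. -/
lemma exists_chain_to_fibers (G : SimpleGraph V) (w : ℕ) (f : V → W) (g : V → W')
    (hdeg : ∀ P : Finpartition (univ : Finset V), FiberSaturated P f → RefinesFibers P g →
      ∀ A ∈ P.parts, quotDeg G P A ≤ w)
    (P : Finpartition (univ : Finset V)) (hf : FiberSaturated P f) (hg : RefinesFibers P g) :
    ∃ Q, FiberSaturated Q g ∧ RefinesFibers Q g ∧
      Relation.ReflTransGen (BoundedMerge G w) P Q := by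
  induction hn : P.parts.card using Nat.strong_induction_on generalizing P with
  | _ n ih =>
  by_cases h : FiberSaturated P g
  · exact ⟨P, h, hg, .refl⟩
  simp only [FiberSaturated, not_forall] at h
  obtain ⟨A, hA, x, hxA, y, hxy, hyA⟩ := h
  obtain ⟨B, hB, hyB⟩ := P.exists_mem (mem_univ y)
  have hAB : A ≠ B := by rintro rfl; exact hyA hyB
  obtain ⟨Q, hQ⟩ := exists_merge P hA hB hAB
  have hQg : RefinesFibers Q g := by
    intro C hC u hu v hv
    rw [hQ] at hC
    rcases mem_insert.1 hC with rfl | hC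
    · have key : ∀ z ∈ A ∪ B, g z = g x := fun z hz => by
        rcases mem_union.1 hz with hz | hz
        · exact hg A hA z hz x hxA
        · exact (hg B hB z hz y hyB).trans hxy.symm
      rw [key u hu, key v hv]
    · simp only [mem_erase] at hC
      exact hg C hC.2.2 u hu v hv
  have hQf : FiberSaturated Q f := by
    intro C hC u hu v huv
    rw [hQ] at hC
    rcases mem_insert.1 hC with rfl | hC
    · rcases mem_union.1 hu with hu | hu
      · exact mem_union_left _ (hf A hA u hu v huv)
      · exact mem_union_right _ (hf B hB u hu v huv)
    · simp only [mem_erase] at hC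
      exact hf C hC.2.2 u hu v huv
  have hcard : Q.parts.card < n := by
    have hB' : B ∈ P.parts.erase A := mem_erase.2 ⟨hAB.symm, hB⟩
    have h1 := card_erase_add_one hA
    have h2 := card_erase_add_one hB'
    have h3 := card_insert_le (A ∪ B) ((P.parts.erase A).erase B)
    rw [← hQ] at h3
    omega
  obtain ⟨R, hR1, hR2, hR⟩ := ih _ hcard Q hQf hQg rfl
  exact ⟨R, hR1, hR2, .head ⟨⟨A, hA, B, hB, hAB, hQ⟩, hdeg Q hQf hQg⟩ hR⟩

lemma quotDeg_le_of_code (G : SimpleGraph V) {q m : ℕ} (f : V → W) (g : V → W') (c : V → Fin q)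
    (hfgc : ∀ x y, g x = g y → c x = c y → f x = f y)
    (N : W' → Finset W') (hN : ∀ x, (N (g x)).card ≤ m)
    (hadj : ∀ x y, G.Adj x y → g y ∈ N (g x))
    (P : Finpartition (univ : Finset V)) (hf : FiberSaturated P f) (hg : RefinesFibers P g)
    (A : Finset V) (hA : A ∈ P.parts) : quotDeg G P A ≤ m * q := by
  obtain ⟨x₀, hx₀⟩ := P.nonempty_of_mem_parts hA
  have hex : ∀ B : {B : Finset V // B ∈ P.parts ∧ B ≠ A ∧ ∃ u ∈ A, ∃ v ∈ B, G.Adj u v},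
      ∃ v ∈ B.1, g v ∈ N (g x₀) := by
    rintro ⟨B, -, -, u, hu, v, hv, huv⟩
    exact ⟨v, hv, hg A hA u hu x₀ hx₀ ▸ hadj u v huv⟩
  choose r hr hrN using hex
  have hinj : Function.Injective
      (fun B => ((⟨g (r B), hrN B⟩, c (r B)) : {z // z ∈ N (g x₀)} × Fin q)) := by
    intro B C h
    simp only [Prod.mk.injEq, Subtype.mk.injEq] at h
    have hmem := hf B.1 B.2.1 _ (hr B) _ (hfgc _ _ h.1 h.2)
    exact Subtype.ext (P.disjoint.elim_finset B.2.1 C.2.1 _ hmem (hr C))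
  calc quotDeg G P A ≤ Nat.card ({z // z ∈ N (g x₀)} × Fin q) :=
        Nat.card_le_card_of_injective _ hinj
    _ = (N (g x₀)).card * q := by simp
    _ ≤ m * q := Nat.mul_le_mul_right _ (hN x₀)

lemma seqOK_of_chain (G : SimpleGraph V) (w : ℕ) {Q : Finpartition (univ : Finset V)}
    (hbot : ∀ A ∈ (⊥ : Finpartition (univ : Finset V)).parts, quotDeg G ⊥ A ≤ w)
    (hchain : Relation.ReflTransGen (BoundedMerge G w) ⊥ Q) (hQ : Q.parts.card ≤ 1) :
    SeqOK G quotDeg w := by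
  have key : ∃ n : ℕ, ∃ P : Fin (n + 1) → Finpartition (univ : Finset V), P 0 = ⊥ ∧
      P (Fin.last n) = Q ∧ (∀ i : Fin n, IsMergeStep (P i.castSucc) (P i.succ)) ∧
      (∀ i, ∀ A ∈ (P i).parts, quotDeg G (P i) A ≤ w) := by
    clear hQ
    induction hchain with
    | refl => exact ⟨0, fun _ => ⊥, rfl, rfl, fun i => i.elim0, fun _ => hbot⟩
    | @tail Q R _ hQR ih =>
      obtain ⟨n, P, h0, hl, hs, hd⟩ := ih
      refine ⟨n + 1, Fin.snoc P R, ?_, by simp, ?_, ?_⟩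
      · rw [← Fin.castSucc_zero, Fin.snoc_castSucc, h0]
      · intro i
        induction i using Fin.lastCases with
        | last => simpa [hl] using hQR.1
        | cast i => simpa only [Fin.succ_castSucc, Fin.snoc_castSucc] using hs i
      · intro i
        induction i using Fin.lastCases with
        | last => simpa using hQR.2
        | cast i => simpa using hd i
  obtain ⟨n, P, h0, hl, hs, hd⟩ := key
  refine ⟨n, P, ?_, hl ▸ hQ, hs, hd⟩
  intro A hA
  rw [h0, Finpartition.mem_bot_iff] at hA
  obtain ⟨a, -, rfl⟩ := hA
  exact card_singleton a

lemma card_parts_le_one {P : Finpartition (univ : Finset V)} {g : V → W}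
    (hP : FiberSaturated P g) (hg : ∀ x y, g x = g y) : P.parts.card ≤ 1 := by
  refine card_le_one.2 fun A hA B hB => ?_
  obtain ⟨x, hx⟩ := P.nonempty_of_mem_parts hA
  obtain ⟨y, hy⟩ := P.nonempty_of_mem_parts hB
  exact P.disjoint.elim_finset hA hB y (hP A hA x hx y (hg x y)) hy

end Contraction

section CloseLists

variable {S : Type*}

lemma Close.symm {L M : List S} (h : Close L M) : Close M L := by
  obtain ⟨i, hi, j, hj, h⟩ := h
  exact ⟨j, hj, i, hi, h.symm⟩

lemma close_refl {L : List S} (h : L ≠ []) : Close L L :=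
  ⟨0, List.length_pos_iff.2 h, 0, List.length_pos_iff.2 h, rfl⟩

lemma Close.take {L M : List S} {n k : ℕ} (hL : L.length = n) (hM : M.length = n)
    (h : Close L M) : L.take k = M.take k ∨ Close (L.take k) (M.take k) := by
  wlog hij : ∃ i < L.length, ∃ j < M.length, i ≤ j ∧ L.eraseIdx i = M.eraseIdx j generalizing L M
  · obtain ⟨i, hi, j, hj, he⟩ := h
    rcases le_total i j with hle | hle
    · exact absurd ⟨i, hi, j, hj, hle, he⟩ hij
    · exact (this hM hL ⟨j, hj, i, hi, he.symm⟩ ⟨j, hj, i, hi, hle, he.symm⟩).imp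
        Eq.symm Close.symm
  obtain ⟨i, hi, j, hj, hle, he⟩ := hij
  have hp : ∀ t, (if t < i then L[t]? else L[t + 1]?) = if t < j then M[t]? else M[t + 1]? := by
    intro t
    rw [← List.getElem?_eraseIdx, ← List.getElem?_eraseIdx, he]
  by_cases hik : i < k
  · right
    refine ⟨i, by simp; omega, min j (k - 1), by simp; omega, List.ext_getElem? fun t => ?_⟩
    have := hp t
    simp only [List.getElem?_eraseIdx, List.getElem?_take]
    grind
  · left
    refine List.ext_getElem? fun t => ?_
    have := hp t
    simp only [List.getElem?_take]
    grind

/-- The lists of length `n` over `Fin q`. -/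
def listsOfLength (q n : ℕ) : Finset (List (Fin q)) :=
  univ.image fun v : Fin n → Fin q => List.ofFn v

lemma mem_listsOfLength {q n : ℕ} {L : List (Fin q)} (h : L.length = n) :
    L ∈ listsOfLength q n := by
  subst h
  exact mem_image.2 ⟨L.get, mem_univ _, List.ofFn_get L⟩

lemma card_listsOfLength_le (q n : ℕ) : (listsOfLength q n).card ≤ q ^ n :=
  card_image_le.trans (by simp)

/-- A finite set containing all lists of the length of `L` which are equal or close to `L`. -/
def nearLists {q : ℕ} (L : List (Fin q)) : Finset (List (Fin q)) :=
  if L = [] then {[]} else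
    (range L.length ×ˢ range L.length ×ˢ univ).image fun p =>
      (L.eraseIdx p.1).insertIdx p.2.1 p.2.2

lemma mem_nearLists {q : ℕ} {L M : List (Fin q)} (hl : M.length = L.length)
    (h : M = L ∨ Close L M) : M ∈ nearLists L := by
  unfold nearLists
  split_ifs with hL
  · subst hL
    simpa using hl
  · have hc : Close L M := by
      rcases h with rfl | h
      · exact close_refl hL
      · exact h
    obtain ⟨i, hi, j, hj, he⟩ := hc
    refine mem_image.2 ⟨(i, j, M[j]), by simp [hi, hl ▸ hj], ?_⟩
    simp only [he]
    exact List.insertIdx_eraseIdx_getElem hj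

lemma card_nearLists_le {q r : ℕ} (hq : 0 < q) (hr : 0 < r) {L : List (Fin q)}
    (hL : L.length ≤ r) : (nearLists L).card ≤ r ^ 2 * q := by
  unfold nearLists
  split_ifs
  · rw [card_singleton]
    exact Nat.mul_pos (pow_pos hr 2) hq
  · refine card_image_le.trans ?_
    simp only [card_product, card_range, card_univ, Fintype.card_fin]
    rw [← mul_assoc, sq]
    gcongr

end CloseLists

section Truncation

variable {a q : ℕ} {rfn : Fin a → ℕ}

/-- Truncate the `i`-th coordinate of `v` to its first `k i` entries. -/
def truncate (k : Fin a → ℕ) (v : ∀ i : Fin a, Fin (rfn i) → Fin q) (i : Fin a) :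
    List (Fin q) :=
  (List.ofFn (v i)).take (k i)

lemma length_truncate {k : Fin a → ℕ} (hk : ∀ i, k i ≤ rfn i)
    (v : ∀ i : Fin a, Fin (rfn i) → Fin q) (i : Fin a) : (truncate k v i).length = k i := by
  simp [truncate, hk i]

/-- The tuples of lists with at least `b` coordinates near those of `u`. -/
def nearTuples (b : ℕ) (u : Fin a → List (Fin q)) : Finset (Fin a → List (Fin q)) :=
  (powersetCard b univ).biUnion fun I =>
    Fintype.piFinset fun i => if i ∈ I then nearLists (u i) else listsOfLength q (u i).length

lemma card_nearTuples_le {b r : ℕ} (hq : 0 < q) (hr : 0 < r) (u : Fin a → List (Fin q))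
    (hu : ∀ i, (u i).length ≤ r) :
    (nearTuples b u).card ≤ a ^ b * ((r ^ 2 * q) ^ b * (q ^ r) ^ (a - b)) := by
  refine (card_biUnion_le_card_mul _ _ ((r ^ 2 * q) ^ b * (q ^ r) ^ (a - b)) ?_).trans ?_
  · intro I hI
    have hIb := (mem_powersetCard.1 hI).2
    rw [Fintype.card_piFinset]
    calc ∏ i, (if i ∈ I then nearLists (u i) else listsOfLength q (u i).length).card
        ≤ ∏ i, if i ∈ I then r ^ 2 * q else q ^ r := by
          refine prod_le_prod' fun i _ => ?_
          split_ifs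
          · exact card_nearLists_le hq hr (hu i)
          · exact (card_listsOfLength_le _ _).trans (Nat.pow_le_pow_right hq (hu i))
      _ = (r ^ 2 * q) ^ b * (q ^ r) ^ (a - b) := by
          rw [prod_ite, prod_const, prod_const, filter_not, filter_mem_eq_inter, univ_inter,
            ← compl_eq_univ_sdiff, card_compl, hIb, Fintype.card_fin]
  · rw [card_powersetCard, card_univ, Fintype.card_fin]
    exact Nat.mul_le_mul_right _ (Nat.choose_le_pow a b)

lemma truncate_mem_nearTuples {b : ℕ} {k : Fin a → ℕ} (hk : ∀ i, k i ≤ rfn i)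
    {x y : ∀ i : Fin a, Fin (rfn i) → Fin q} (h : (PiGraph a b q rfn).Adj x y) :
    truncate k y ∈ nearTuples b (truncate k x) := by
  have hI : ∃ I : Finset (Fin a), I.card = b ∧
      ∀ i ∈ I, x i = y i ∨ Close (List.ofFn (x i)) (List.ofFn (y i)) := by
    rcases h.2 with h | ⟨I, hI, h⟩
    · exact h
    · exact ⟨I, hI, fun i hi => (h i hi).imp Eq.symm Close.symm⟩
  obtain ⟨I, hIb, hI⟩ := hI
  refine mem_biUnion.2 ⟨I, mem_powersetCard.2 ⟨subset_univ _, hIb⟩, ?_⟩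
  refine Fintype.mem_piFinset.2 fun i => ?_
  have hlen : (truncate k y i).length = (truncate k x i).length := by
    rw [length_truncate hk, length_truncate hk]
  split_ifs with hi
  · refine mem_nearLists hlen ?_
    rcases hI i hi with h | h
    · exact .inl (by simp [truncate, h])
    · exact (h.take List.length_ofFn List.length_ofFn).imp Eq.symm id
  · exact mem_listsOfLength hlen

lemma truncate_full_injective :
    Function.Injective (truncate rfn : (∀ i : Fin a, Fin (rfn i) → Fin q) → _) := by
  intro x y h
  funext i
  have := congrFun h i
  simp only [truncate] at this
  rw [List.take_of_length_le (by simp), List.take_of_length_le (by simp)] at this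
  exact List.ofFn_injective this

lemma exists_chain_from_truncation (G : SimpleGraph (∀ i : Fin a, Fin (rfn i) → Fin q)) {m : ℕ}
    (N : (Fin a → List (Fin q)) → Finset (Fin a → List (Fin q)))
    (hN : ∀ k : Fin a → ℕ, (∀ i, k i ≤ rfn i) →
      ∀ x : ∀ i : Fin a, Fin (rfn i) → Fin q, (N (truncate k x)).card ≤ m)
    (hadj : ∀ k : Fin a → ℕ, (∀ i, k i ≤ rfn i) →
      ∀ x y, G.Adj x y → truncate k y ∈ N (truncate k x))
    (n : ℕ) (k : Fin a → ℕ) (hk : ∀ i, k i ≤ rfn i) (hn : ∑ i, k i = n)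
    (P : Finpartition (univ : Finset (∀ i : Fin a, Fin (rfn i) → Fin q)))
    (hP : FiberSaturated P (truncate k)) (hP' : RefinesFibers P (truncate k)) :
    ∃ Q, Q.parts.card ≤ 1 ∧ Relation.ReflTransGen (BoundedMerge G (m * q)) P Q := by
  induction n generalizing k P with
  | zero =>
    refine ⟨P, card_parts_le_one hP fun x y => ?_, .refl⟩
    have hk0 : ∀ i, k i = 0 := by simpa using hn
    funext i
    simp [truncate, hk0]
  | succ n ih =>
    obtain ⟨i, hi⟩ : ∃ i, 0 < k i := by
      by_contra! h
      simp [fun i => Nat.le_zero.1 (h i)] at hn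
    obtain ⟨d, hd⟩ : ∃ d, k i = d + 1 := ⟨k i - 1, by omega⟩
    have hdr : d < rfn i := by have := hk i; omega
    let k' := Function.update k i d
    have hk'k : ∀ j, k' j ≤ k j := by
      intro j
      by_cases hj : j = i
      · subst hj; simp [k', hd]
      · simp [k', hj]
    have hk' : ∀ j, k' j ≤ rfn j := fun j => (hk'k j).trans (hk j)
    have hsum : ∑ j, k' j = n := by
      have h1 := sum_update_of_mem (mem_univ i) k d
      have h2 := sum_eq_add_sum_sdiff_singleton_of_mem (mem_univ i) k
      simp only [k']
      omega
    obtain ⟨Q, hQ1, hQ2, hQ⟩ := exists_chain_to_fibers G (m * q) (truncate k) (truncate k')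
      (quotDeg_le_of_code G (truncate k) (truncate k') (fun x => x i ⟨d, hdr⟩) (by
        intro x y hxy hc
        funext j
        have hj := congrFun hxy j
        by_cases hji : j = i
        · subst hji
          simp only [truncate, k', Function.update_self] at hj
          simp only [truncate, hd, List.take_add_one, hj]
          simp [hdr, hc]
        · simpa [truncate, k', hji] using hj) N (hN k' hk') (hadj k' hk'))
      P hP (by
        intro A hA x hx y hy
        funext j
        have hj := congrArg (List.take (k' j)) (congrFun (hP' A hA x hx y hy) j)
        simpa [truncate, List.take_take, hk'k j] using hj)
    obtain ⟨R, hR, hQR⟩ := ih k' hk' hsum Q hQ1 hQ2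
    exact ⟨R, hR, hQ.trans hQR⟩

end Truncation

theorem statement_5 (a b q r : ℕ) (rfn : Fin a → ℕ)
    (hq : 2 ≤ q) (hb : 0 < b) (hba : b ≤ a) (hr0 : 0 < r)
    (hri : ∀ i, 0 < rfn i) (hrr : ∀ i, rfn i ≤ r) :
    stww (PiGraph a b q rfn) ≤ r ^ (2 * b) * a ^ b * q ^ (a * r - b * (r - 1) + 1) := by
  have hq0 : 0 < q := by omega
  let m := a ^ b * ((r ^ 2 * q) ^ b * (q ^ r) ^ (a - b))
  have hm : m * q = r ^ (2 * b) * a ^ b * q ^ (a * r - b * (r - 1) + 1) := by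
    have hexp : a * r - b * (r - 1) = b + r * (a - b) := by
      obtain ⟨c, rfl⟩ := Nat.exists_eq_add_of_le hba
      obtain ⟨s, rfl⟩ := Nat.exists_eq_add_of_le hr0
      have h1 : 1 + s - 1 = s := by omega
      have h2 : b + c - b = c := by omega
      rw [h1, h2]
      refine Nat.sub_eq_of_eq_add ?_
      ring
    rw [hexp]
    simp only [m]
    ring
  rw [← hm]
  refine Nat.sInf_le ?_
  have hN : ∀ k : Fin a → ℕ, (∀ i, k i ≤ rfn i) →
      ∀ x : ∀ i : Fin a, Fin (rfn i) → Fin q, (nearTuples b (truncate k x)).card ≤ m :=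
    fun k hk x => card_nearTuples_le hq0 hr0 _ fun i => by
      rw [length_truncate hk]
      exact (hk i).trans (hrr i)
  have hadj : ∀ k : Fin a → ℕ, (∀ i, k i ≤ rfn i) → ∀ x y, (PiGraph a b q rfn).Adj x y →
      truncate k y ∈ nearTuples b (truncate k x) := fun k hk _ _ h => truncate_mem_nearTuples hk h
  have hsat : FiberSaturated (⊥ : Finpartition
      (univ : Finset (∀ i : Fin a, Fin (rfn i) → Fin q))) (truncate rfn) := by
    intro A hA x hx y hxy
    rwa [← truncate_full_injective hxy]
  have href : RefinesFibers (⊥ : Finpartition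
      (univ : Finset (∀ i : Fin a, Fin (rfn i) → Fin q))) (truncate rfn) := by
    intro A hA x hx y hy
    obtain ⟨z, -, rfl⟩ := Finpartition.mem_bot_iff.1 hA
    rw [mem_singleton.1 hx, mem_singleton.1 hy]
  obtain ⟨Q, hQ, hchain⟩ := exists_chain_from_truncation (PiGraph a b q rfn) (nearTuples b)
    hN hadj _ rfn (fun _ => le_rfl) rfl ⊥ hsat href
  exact seqOK_of_chain _ _ (quotDeg_le_of_code _ (truncate rfn) (truncate rfn)
    (fun _ => (⟨0, hq0⟩ : Fin q)) (fun _ _ h _ => h) (nearTuples b) (hN rfn fun _ => le_rfl)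
    (hadj rfn fun _ => le_rfl) ⊥ hsat href) hchain hQ

end TwwPaper
end
end

section
/- There exists a constant C₀ > 0 (e.g. C₀ = 24000) such that for every 0 < ε ≤ 1/3 there exists n₀ with the following property: for all n ≥ n₀ and m with (1+ε)n ≤ m ≤ (1/10)·n·log n, the number of graphs G with vertex set [n], exactly m edges, and stww(G) ≤ ε·d·(n/log n)^{(d−2)/(2d−2)} is at most (C₀·ε·n²/m)^m, where d = 2m/n. -/
noncomputable section

namespace TwwPaper

open Finset

variable {V : Type*}

/-- The number of graphs with `m` edges, all of them in `T`. -/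
theorem card_filter_edgeSet_subset_le [Fintype V] (m : ℕ) (T : Finset (Sym2 V))
    (S : Finset (SimpleGraph V))
    (hS : ∀ G ∈ S, edgeCount G = m ∧ G.edgeSet ⊆ T) : S.card ≤ T.card.choose m := by
  classical
  rw [← card_powersetCard]
  refine card_le_card_of_injOn (fun G => G.edgeFinset) ?_ ?_
  · intro G hG
    obtain ⟨h₁, h₂⟩ := hS G hG
    refine mem_powersetCard.2 ⟨fun e he => h₂ (by simpa using he), ?_⟩
    rw [← h₁, edgeCount, Nat.card_eq_fintype_card, SimpleGraph.edgeFinset_card]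
  · intro G _ H _ h
    simpa using h

section Counting

variable [Fintype V] [DecidableEq V]

/-- Two distinct parts of a partition can be merged. -/
theorem exists_isMergeStep (P : Finpartition (univ : Finset V)) (hP : 1 < P.parts.card) :
    ∃ Q, IsMergeStep P Q ∧ Q.parts.card < P.parts.card := by
  obtain ⟨A, hA, B, hB, hAB⟩ := Finset.one_lt_card.1 hP
  have huniq : ∀ C ∈ P.parts, ∀ D ∈ P.parts, ∀ v, v ∈ C → v ∈ D → C = D :=
    fun C hC D hD v h₁ h₂ => P.eq_of_mem_parts hC hD h₁ h₂
  refine ⟨Finpartition.ofExistsUnique (insert (A ∪ B) ((P.parts.erase A).erase B))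
    (fun _ _ => subset_univ _) ?_ ?_, ⟨A, hA, B, hB, hAB, rfl⟩, ?_⟩
  · intro v hv
    obtain ⟨C, hC, hvC⟩ := P.exists_mem (mem_univ v)
    by_cases h : C = A ∨ C = B
    · refine ⟨A ∪ B, ⟨mem_insert_self _ _, ?_⟩, ?_⟩
      · rcases h with rfl | rfl <;> simp [hvC]
      · rintro D ⟨hD, hvD⟩
        rcases mem_insert.1 hD with hD | hD
        · exact hD
        · simp only [mem_erase] at hD
          have := huniq D hD.2.2 C hC v hvD hvC
          grind
    · push Not at h
      refine ⟨C, ⟨by simp [h.1, h.2, hC], hvC⟩, ?_⟩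
      rintro D ⟨hD, hvD⟩
      rcases mem_insert.1 hD with rfl | hD
      · rcases mem_union.1 hvD with hvD | hvD
        · exact absurd (huniq C hC A hA v hvC hvD) h.1
        · exact absurd (huniq C hC B hB v hvC hvD) h.2
      · simp only [mem_erase] at hD
        exact huniq D hD.2.2 C hC v hvD hvC
  · intro h
    rcases mem_insert.1 h with h | h
    · have hA0 : A = ∅ := by
        have : A ⊆ ∅ := h ▸ subset_union_left
        simpa using this
      exact P.empty_notMem_parts (hA0 ▸ hA)
    · simp only [mem_erase] at h
      exact P.empty_notMem_parts h.2.2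
  · have h₁ := card_insert_le (A ∪ B) ((P.parts.erase A).erase B)
    have h₂ : ((P.parts.erase A).erase B).card + 1 = (P.parts.erase A).card :=
      card_erase_add_one (by simp [hB, hAB.symm])
    have h₃ : (P.parts.erase A).card + 1 = P.parts.card := card_erase_add_one hA
    change (insert (A ∪ B) ((P.parts.erase A).erase B)).card < _
    omega

/-- Every partition can be contracted to at most one part. -/
theorem exists_mergeSequence (k : ℕ) (Q : Finpartition (univ : Finset V))
    (hQ : Q.parts.card ≤ k + 1) :
    ∃ n : ℕ, ∃ P : Fin (n + 1) → Finpartition (univ : Finset V),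
      P 0 = Q ∧ (P (Fin.last n)).parts.card ≤ 1 ∧
      ∀ i : Fin n, IsMergeStep (P i.castSucc) (P i.succ) := by
  induction k generalizing Q with
  | zero => exact ⟨0, fun _ => Q, rfl, hQ, fun i => i.elim0⟩
  | succ k ih =>
    by_cases h : Q.parts.card ≤ 1
    · exact ⟨0, fun _ => Q, rfl, h, fun i => i.elim0⟩
    · obtain ⟨Q', hQ', hcard⟩ := exists_isMergeStep Q (by omega)
      obtain ⟨n, P, hP0, hlast, hstep⟩ := ih Q' (by omega)
      refine ⟨n + 1, Fin.cons Q P, rfl, ?_, ?_⟩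
      · rw [← Fin.succ_last, Fin.cons_succ]
        exact hlast
      · intro i
        refine Fin.cases ?_ (fun j => ?_) i
        · rw [Fin.cons_succ, hP0]
          exact hQ'
        · rw [← Fin.succ_castSucc, Fin.cons_succ, Fin.cons_succ]
          exact hstep j

theorem seqOK_stww (G : SimpleGraph V) : SeqOK G quotDeg (stww G) := by
  refine Nat.sInf_mem (s := {w | SeqOK G quotDeg w}) ⟨Nat.card (Finset V), ?_⟩
  obtain ⟨n, P, hP0, hlast, hstep⟩ :=
    exists_mergeSequence (⊥ : Finpartition (univ : Finset V)).parts.card ⊥ (by omega)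
  refine ⟨n, P, ?_, hlast, hstep, ?_⟩
  · intro A hA
    rw [hP0, Finpartition.mem_bot_iff] at hA
    obtain ⟨a, -, rfl⟩ := hA
    simp
  · intro i A _
    exact Finite.card_subtype_le _

theorem SeqOK.mono {G : SimpleGraph V} {w w' : ℕ} (h : SeqOK G quotDeg w) (hw : w ≤ w') :
    SeqOK G quotDeg w' := by
  obtain ⟨n, P, h₀, h₁, h₂, h₃⟩ := h
  exact ⟨n, P, h₀, h₁, h₂, fun i A hA => (h₃ i A hA).trans hw⟩

theorem edgeCount_eq_zero_of_stww_eq_zero {G : SimpleGraph V} (h : stww G = 0) :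
    edgeCount G = 0 := by
  obtain ⟨n, P, h₀, -, -, h₃⟩ := seqOK_stww G
  have hbot : G = ⊥ := by
    ext u v
    simp only [SimpleGraph.bot_adj, iff_false]
    intro huv
    have hpart : ∀ x, {x} ∈ (P 0).parts := by
      intro x
      obtain ⟨C, hC, hxC⟩ := (P 0).exists_mem (mem_univ x)
      obtain ⟨y, rfl⟩ := card_eq_one.1 (h₀ C hC)
      rw [mem_singleton.1 hxC]
      exact hC
    have hdeg := h₃ 0 {u} (hpart u)
    rw [h, Nat.le_zero, quotDeg, Nat.card_eq_zero] at hdeg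
    rcases hdeg with hdeg | hdeg
    · refine hdeg.elim ⟨{v}, hpart v, ?_, u, by simp, v, by simp, huv⟩
      simpa using huv.ne'
    · exact absurd (inferInstance : Finite _) (not_finite_iff_infinite.2 hdeg)
  simp [edgeCount, hbot]

/-- A contraction sequence of maximum degree at most `w` groups the vertices of `R` into chunks
of size less than `2 * s`, all but one of size at least `s`, whose quotient graph has an
orientation of maximum outdegree at most `w`. -/
theorem exists_chunks_of_mergeSequence (G : SimpleGraph V) {w s : ℕ} (hs : 0 < s) (n : ℕ)
    (P : Fin (n + 1) → Finpartition (univ : Finset V))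
    (hlast : (P (Fin.last n)).parts.card ≤ 1)
    (hstep : ∀ i : Fin n, IsMergeStep (P i.castSucc) (P i.succ))
    (hdeg : ∀ i, ∀ A ∈ (P i).parts, quotDeg G (P i) A ≤ w)
    (R : Finset V) (hR : ∀ A ∈ (P 0).parts, (R ∩ A).card < s) :
    ∃ (f : V → ℕ) (O : ℕ → Finset ℕ),
      (∀ v ∈ R, f v < R.card / s + 1) ∧ (∀ a, (O a).card ≤ w) ∧
      (∀ a, (R.filter (f · = a)).card < 2 * s) ∧
      (∀ A ∈ (P 0).parts, ∀ u ∈ R ∩ A, ∀ v ∈ R ∩ A, f u = f v) ∧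
      ∀ u ∈ R, ∀ v ∈ R, G.Adj u v → f u = f v ∨ f v ∈ O (f u) ∨ f u ∈ O (f v) := by
  induction n generalizing R with
  | zero =>
    refine ⟨fun _ => 0, fun _ => ∅, by simp, by simp, fun a => ?_, by simp, by simp⟩
    refine (card_filter_le _ _).trans_lt ?_
    rcases R.eq_empty_or_nonempty with rfl | ⟨v, hv⟩
    · simp [hs]
    · obtain ⟨A, hA, -⟩ := (P 0).exists_mem (mem_univ v)
      have hsub : R ⊆ A := by
        intro x _
        obtain ⟨B, hB, hxB⟩ := (P 0).exists_mem (mem_univ x)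
        rwa [card_le_one.1 hlast A hA B hB]
      have := hR A hA
      rw [inter_eq_left.2 hsub] at this
      omega
  | succ n ih =>
    obtain ⟨A, hA, B, hB, hAB, hparts⟩ := hstep 0
    simp only [Fin.castSucc_zero, Fin.succ_zero_eq_one] at hA hB hparts
    have ih' := ih (fun i => P i.succ) (by simpa using hlast)
      (fun i => by simpa using hstep i.succ) (fun i => hdeg i.succ)
    simp only [Fin.succ_zero_eq_one] at ih'
    have hmem : ∀ C, C ∈ (P 1).parts ↔ C = A ∪ B ∨ C ≠ B ∧ C ≠ A ∧ C ∈ (P 0).parts := by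
      intro C
      simp [hparts]
    have hold : ∀ C ∈ (P 0).parts, ∃ D ∈ (P 1).parts, C ⊆ D := by
      intro C hC
      by_cases h : C = A ∨ C = B
      · exact ⟨A ∪ B, by simp [hmem], by rcases h with rfl | rfl <;> simp⟩
      · exact ⟨C, by rw [hmem]; tauto, subset_rfl⟩
    by_cases hbig : (R ∩ (A ∪ B)).card < s
    · obtain ⟨f, O, h₁, h₂, h₃, h₄, h₅⟩ := ih' R (by
        intro C hC
        rcases (hmem C).1 hC with rfl | hC
        · exact hbig
        · exact hR C hC.2.2)
      refine ⟨f, O, h₁, h₂, h₃, ?_, h₅⟩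
      intro C hC u hu v hv
      obtain ⟨D, hD, hCD⟩ := hold C hC
      exact h₄ D hD u (inter_subset_inter_left hCD hu) v (inter_subset_inter_left hCD hv)
    · set X := R ∩ (A ∪ B) with hX
      obtain ⟨f, O, h₁, h₂, h₃, h₄, h₅⟩ := ih' (R \ X) (by
        intro C hC
        rcases (hmem C).1 hC with rfl | hC
        · have : (R \ X) ∩ (A ∪ B) = ∅ := by
            ext v
            simp [hX]
          simp [this, hs]
        · exact (card_le_card (inter_subset_inter_right sdiff_subset)).trans_lt
            (hR C hC.2.2))
      have hABmem : A ∪ B ∈ (P 1).parts := by simp [hmem]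
      set K := (R \ X).card / s + 1 with hK
      have hXR : X ⊆ R := inter_subset_left
      have hKR : K + 1 ≤ R.card / s + 1 := by
        have h := card_sdiff_add_card_eq_card hXR
        have : (R \ X).card / s + 1 ≤ R.card / s := by
          rw [← Nat.add_div_right _ hs]
          exact Nat.div_le_div_right (by omega)
        omega
      have hXcard : X.card < 2 * s := by
        have h := card_union_le (R ∩ A) (R ∩ B)
        rw [← inter_union_distrib_left, ← hX] at h
        have := hR A hA
        have := hR B hB
        omega
      classical
      set N : Finset (Finset V) :=
        (P 1).parts.filter (fun C => C ≠ A ∪ B ∧ ∃ u ∈ A ∪ B, ∃ v ∈ C, G.Adj u v) with hN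
      have hNcard : N.card ≤ w := by
        have h := hdeg 1 (A ∪ B) hABmem
        rw [quotDeg, Nat.subtype_card N (by intro C; simp [hN])] at h
        exact h
      have hlabel : ∀ C, ∃ a, C ∈ (P 1).parts → ∀ v ∈ (R \ X) ∩ C, f v = a := by
        intro C
        by_cases hC : C ∈ (P 1).parts ∧ ((R \ X) ∩ C).Nonempty
        · obtain ⟨hC, v, hv⟩ := hC
          exact ⟨f v, fun _ u hu => h₄ C hC u hu v hv⟩
        · refine ⟨0, fun hC' v hv => absurd ⟨hC', v, hv⟩ hC⟩
      choose g hg using hlabel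
      have hout : ∀ u ∈ X, ∀ v ∈ R \ X, G.Adj u v → f v ∈ N.image g := by
        intro u hu v hv huv
        obtain ⟨C, hC, hvC⟩ := (P 1).exists_mem (mem_univ v)
        refine mem_image.2 ⟨C, ?_, (hg C hC v (mem_inter.2 ⟨hv, hvC⟩)).symm⟩
        refine mem_filter.2 ⟨hC, ?_, u, (mem_inter.1 hu).2, v, hvC, huv⟩
        rintro rfl
        exact (mem_sdiff.1 hv).2 (mem_inter.2 ⟨(mem_sdiff.1 hv).1, hvC⟩)
      refine ⟨fun v => if v ∈ X then K else f v,
        fun a => if a = K then N.image g else O a, ?_, ?_, ?_, ?_, ?_⟩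
      · intro v hv
        by_cases hvX : v ∈ X
        · simp only [hvX, if_true]
          omega
        · simp only [hvX, if_false]
          have := h₁ v (mem_sdiff.2 ⟨hv, hvX⟩)
          omega
      · intro a
        by_cases ha : a = K
        · simp only [ha, if_true]
          exact card_image_le.trans hNcard
        · simpa only [ha, if_false] using h₂ a
      · intro a
        by_cases ha : a = K
        · refine (card_le_card ?_).trans_lt hXcard
          intro v hv
          obtain ⟨hvR, hv⟩ := mem_filter.1 hv
          by_contra hvX
          simp only [hvX, if_false] at hv
          have := h₁ v (mem_sdiff.2 ⟨hvR, hvX⟩)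
          omega
        · refine (card_le_card ?_).trans_lt (h₃ a)
          intro v hv
          obtain ⟨hvR, hv⟩ := mem_filter.1 hv
          by_cases hvX : v ∈ X
          · simp only [hvX, if_true] at hv
            omega
          · simp only [hvX, if_false] at hv
            exact mem_filter.2 ⟨mem_sdiff.2 ⟨hvR, hvX⟩, hv⟩
      · intro C hC u hu v hv
        obtain ⟨D, hD, hCD⟩ := hold C hC
        have huD := hCD (mem_inter.1 hu).2
        have hvD := hCD (mem_inter.1 hv).2
        have hiff : ∀ x ∈ R ∩ C, x ∈ X ↔ D = A ∪ B := by
          intro x hx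
          have hxD := hCD (mem_inter.1 hx).2
          constructor
          · intro hxX
            exact (P 1).eq_of_mem_parts hD hABmem hxD (mem_inter.1 hxX).2
          · rintro rfl
            exact mem_inter.2 ⟨(mem_inter.1 hx).1, hxD⟩
        by_cases hDAB : D = A ∪ B
        · simp only [(hiff u hu).2 hDAB, (hiff v hv).2 hDAB, if_true]
        · have huX := mt (hiff u hu).1 hDAB
          have hvX := mt (hiff v hv).1 hDAB
          simp only [huX, hvX, if_false]
          exact h₄ D hD u (mem_inter.2 ⟨mem_sdiff.2 ⟨(mem_inter.1 hu).1, huX⟩, huD⟩)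
            v (mem_inter.2 ⟨mem_sdiff.2 ⟨(mem_inter.1 hv).1, hvX⟩, hvD⟩)
      · intro u hu v hv huv
        by_cases huX : u ∈ X <;> by_cases hvX : v ∈ X
        · simp [huX, hvX]
        · have := hout u huX v (mem_sdiff.2 ⟨hv, hvX⟩) huv
          simp only [huX, hvX, if_true, if_false]
          exact Or.inr (Or.inl this)
        · have := hout v hvX u (mem_sdiff.2 ⟨hu, huX⟩) huv.symm
          simp only [huX, hvX, if_true, if_false]
          exact Or.inr (Or.inr this)
        · have hu' := mem_sdiff.2 ⟨hu, huX⟩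
          have hv' := mem_sdiff.2 ⟨hv, hvX⟩
          have hu₁ : f u ≠ K := (h₁ u hu').ne
          have hv₁ : f v ≠ K := (h₁ v hv').ne
          simp only [huX, hvX, hu₁, hv₁, if_false]
          exact h₅ u hu' v hv' huv

/-- The pairs of vertices allowed by a chunk labelling `f` and out-neighbourhoods `O`. -/
def allowedPairs {K : ℕ} (f : V → Fin K) (O : Fin K → Finset (Fin K)) : Finset (V × V) :=
  univ.filter fun p => f p.2 ∈ insert (f p.1) (O (f p.1))

theorem card_allowedPairs_le {K w s : ℕ} (f : V → Fin K) (O : Fin K → Finset (Fin K))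
    (hf : ∀ a, (univ.filter (f · = a)).card ≤ 2 * s) (hO : ∀ a, (O a).card ≤ w) :
    (allowedPairs f O).card ≤ Fintype.card V * ((w + 1) * (2 * s)) := by
  have hsub : allowedPairs f O ⊆ (univ : Finset V).biUnion fun u =>
      ((insert (f u) (O (f u))).biUnion fun a => univ.filter (f · = a)).image (Prod.mk u) := by
    rintro ⟨u, v⟩ h
    simp only [allowedPairs, mem_filter, mem_univ, true_and] at h
    simp only [mem_biUnion, mem_univ, true_and, mem_image, mem_filter]
    exact ⟨u, v, ⟨f v, h, rfl⟩, rfl⟩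
  refine (card_le_card hsub).trans ?_
  refine card_biUnion_le_card_mul _ _ _ fun u _ => card_image_le.trans ?_
  refine (card_biUnion_le_card_mul _ _ _ fun a _ => hf a).trans ?_
  exact Nat.mul_le_mul_right _ ((card_insert_le _ _).trans (by have := hO (f u); omega))

theorem exists_chunks (G : SimpleGraph V) {w s : ℕ} (hs : 2 ≤ s) (hG : stww G ≤ w)
    (hw : w ≤ Fintype.card V / s + 1) :
    ∃ (f : V → Fin (Fintype.card V / s + 1))
      (O : Fin (Fintype.card V / s + 1) → Finset (Fin (Fintype.card V / s + 1))),
      (∀ a, (univ.filter (f · = a)).card ≤ 2 * s) ∧ (∀ a, (O a).card = w) ∧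
      ∀ u v, G.Adj u v → s(u, v) ∈ (allowedPairs f O).image (fun p => s(p.1, p.2)) := by
  obtain ⟨n, P, h₀, hlast, hstep, hdeg⟩ := (seqOK_stww G).mono hG
  obtain ⟨f, O, h₁, h₂, h₃, -, h₅⟩ := exists_chunks_of_mergeSequence G (by omega : 0 < s) n P
    hlast hstep hdeg univ (by intro A hA; simp [h₀ A hA]; omega)
  simp only [mem_univ, true_imp_iff, card_univ] at h₁ h₅
  set K := Fintype.card V / s + 1 with hK
  have hext : ∀ a : Fin K, ∃ T : Finset (Fin K),
      (univ.filter fun b : Fin K => b.val ∈ O a.val) ⊆ T ∧ T.card = w := by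
    intro a
    refine Finset.exists_superset_card_eq ?_ (by simpa using hw)
    refine le_trans ?_ (h₂ a.val)
    exact card_le_card_of_injOn Fin.val (by intro b hb; simpa using hb)
      (Fin.val_injective.injOn)
  choose T hT hTcard using hext
  have hmemT : ∀ u v, f v ∈ O (f u) → (⟨f v, h₁ v⟩ : Fin K) ∈ T ⟨f u, h₁ u⟩ :=
    fun u v h => hT _ (by simpa using h)
  refine ⟨fun v => ⟨f v, h₁ v⟩, T, fun a => ?_, hTcard, fun u v huv => ?_⟩
  · simpa [Fin.ext_iff] using (h₃ a.val).le
  · simp only [allowedPairs, mem_image, mem_filter, mem_univ, true_and, mem_insert]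
    rcases h₅ u v huv with h | h | h
    · exact ⟨(u, v), Or.inl (by simp [h]), rfl⟩
    · exact ⟨(u, v), Or.inr (hmemT u v h), rfl⟩
    · exact ⟨(v, u), Or.inr (hmemT v u h), Sym2.eq_swap⟩

theorem card_stww_le (m w s : ℕ) (hs : 2 ≤ s) (hw : w ≤ Fintype.card V / s + 1) :
    Nat.card {G : SimpleGraph V // edgeCount G = m ∧ stww G ≤ w} ≤
      (Fintype.card V / s + 1) ^ Fintype.card V *
        (Fintype.card V / s + 1).choose w ^ (Fintype.card V / s + 1) *
        (Fintype.card V * ((w + 1) * (2 * s))).choose m := by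
  classical
  set K := Fintype.card V / s + 1 with hK
  set codes : Finset ((V → Fin K) × (Fin K → Finset (Fin K))) :=
    (univ.filter fun f : V → Fin K => ∀ a, (univ.filter (f · = a)).card ≤ 2 * s) ×ˢ
      Fintype.piFinset fun _ => powersetCard w univ with hcodes
  set fam : (V → Fin K) × (Fin K → Finset (Fin K)) → Finset (SimpleGraph V) := fun c =>
    univ.filter fun G => edgeCount G = m ∧
      G.edgeSet ⊆ (allowedPairs c.1 c.2).image (fun p => s(p.1, p.2)) with hfam
  have hcover : (univ.filter fun G : SimpleGraph V => edgeCount G = m ∧ stww G ≤ w) ⊆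
      codes.biUnion fam := by
    intro G hG
    simp only [mem_filter, mem_univ, true_and] at hG
    obtain ⟨f, O, h₁, h₂, h₃⟩ := exists_chunks G hs hG.2 hw
    refine mem_biUnion.2 ⟨(f, O), ?_, ?_⟩
    · simp only [hcodes, mem_product, mem_filter, mem_univ, true_and, Fintype.mem_piFinset,
        mem_powersetCard, subset_univ]
      exact ⟨h₁, h₂⟩
    · simp only [hfam, mem_filter, mem_univ, true_and]
      refine ⟨hG.1, fun e he => ?_⟩
      induction e using Sym2.ind with
      | _ u v => exact h₃ u v he
  have hfamcard : ∀ c ∈ codes,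
      (fam c).card ≤ (Fintype.card V * ((w + 1) * (2 * s))).choose m := by
    rintro ⟨f, O⟩ hc
    simp only [hcodes, mem_product, mem_filter, mem_univ, true_and, Fintype.mem_piFinset,
      mem_powersetCard, subset_univ] at hc
    refine (card_filter_edgeSet_subset_le m _ _ fun G hG => (mem_filter.1 hG).2).trans ?_
    exact Nat.choose_le_choose _ (card_image_le.trans
      (card_allowedPairs_le f O hc.1 fun a => (hc.2 a).le))
  rw [Nat.card_eq_fintype_card, Fintype.card_subtype]
  refine (card_le_card hcover).trans ((card_biUnion_le_card_mul _ _ _ hfamcard).trans ?_)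
  refine Nat.mul_le_mul_right _ ?_
  rw [hcodes, card_product]
  refine Nat.mul_le_mul ((card_filter_le _ _).trans (by simp)) ?_
  simp

end Counting

theorem choose_le_exp_mul_div_pow (r : ℕ) {n x : ℝ} {N : ℕ} (hN : (N : ℝ) ≤ n) (hx : 0 < x)
    (hr : x ≤ r) :
    (N.choose r : ℝ) ≤ (Real.exp 1 * n / x) ^ r := by
  have hn : 0 ≤ n := le_trans (Nat.cast_nonneg N) hN
  have h₁ : (N.choose r : ℝ) ≤ (N : ℝ) ^ r / (r.factorial : ℝ) := Nat.choose_le_pow_div r N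
  have h₂ : (r : ℝ) ^ r / (r.factorial : ℝ) ≤ Real.exp r :=
    Real.pow_div_factorial_le_exp r (by positivity) r
  have hf : (0 : ℝ) < r.factorial := by positivity
  have h₃ : x ^ r ≤ Real.exp 1 ^ r * r.factorial := by
    rw [← Real.exp_nat_mul, mul_one]
    exact (pow_le_pow_left₀ hx.le hr r).trans ((div_le_iff₀ hf).1 h₂)
  refine h₁.trans ?_
  rw [div_pow, mul_pow, div_le_div_iff₀ hf (by positivity)]
  calc (N : ℝ) ^ r * x ^ r ≤ n ^ r * (Real.exp 1 ^ r * r.factorial) := by gcongr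
    _ = Real.exp 1 ^ r * n ^ r * r.factorial := by ring

/-- The number of chunk labellings is at most `exp (2 * d * n)` times
a power of `x`. -/
theorem labellings_bound {n d x κ : ℝ} {N K : ℕ} (hn : n = N) (hd : 2 < d) (hx : 0 < x)
    (hK : (K : ℝ) ≤ 2 * (d * x ^ κ)) :
    (K : ℝ) ^ N ≤ Real.exp (2 * d * n) * x ^ (κ * n) := by
  calc (K : ℝ) ^ N ≤ (2 * d * x ^ κ) ^ N := by
        rw [mul_assoc]
        gcongr
    _ = (2 * d) ^ N * x ^ (κ * n) := by
        rw [mul_pow, hn, Real.rpow_mul hx.le, Real.rpow_natCast]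
    _ ≤ Real.exp (2 * d) ^ N * x ^ (κ * n) := by
        gcongr
        linarith [Real.add_one_le_exp (2 * d)]
    _ = Real.exp (2 * d * n) * x ^ (κ * n) := by
        rw [← Real.exp_nat_mul, hn, mul_comm (N : ℝ)]

/-- The number of chunk quotient graphs is exponential in the number of edges. -/
theorem quotients_bound {n d L ε W k : ℝ} {K w : ℕ} (hL : 10 ≤ L) (hLn : L = Real.log n)
    (hn : 1 ≤ n) (hd : 2 < d) (hdL : d ≤ L / 5) (hε : 0 < ε) (hε' : ε ≤ 1 / 3)
    (hx : 1 ≤ n / L) (hk : 0 < k) (hW : 0 < W)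
    (hWk : W * k = ε * d ^ 2 * (n / L))
    (hkW : k / W = (n / L) ^ (1 / (d - 1)) / ε)
    (hK : (K : ℝ) ≤ 2 * k) (hw : (w : ℝ) ≤ W) (hw' : W / 2 ≤ w) :
    ((K.choose w : ℕ) : ℝ) ^ K ≤ Real.exp (5 / 2 * d * n) := by
  set x := n / L with hxdef
  have hx0 : 0 < x := by linarith
  have hxn : x ≤ n := div_le_self (by linarith) (by linarith)
  have hd1 : 0 < d - 1 := by linarith
  set y := 4 * Real.exp 1 * (x ^ (1 / (d - 1)) / ε) with hy
  have hpow : 1 ≤ x ^ (1 / (d - 1)) := Real.one_le_rpow hx (by positivity)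
  have hy1 : 1 ≤ y := by
    have h₁ : (1 : ℝ) ≤ Real.exp 1 := Real.one_le_exp (by norm_num)
    have h₂ : 1 ≤ x ^ (1 / (d - 1)) / ε := by
      rw [le_div_iff₀ hε]
      linarith
    nlinarith
  have hy0 : 0 < y := by linarith
  have hlogx : Real.log x ≤ L := by
    rw [hLn]
    exact Real.log_le_log hx0 hxn
  have hlog : Real.log y ≤ 4 + (1 / ε - 1) + L / (d - 1) := by
    have h4 : Real.log 4 ≤ 3 := by
      have := Real.log_le_sub_one_of_pos (by norm_num : (0 : ℝ) < 4)
      linarith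
    have hinv : Real.log (1 / ε) ≤ 1 / ε - 1 := Real.log_le_sub_one_of_pos (by positivity)
    have hsplit : Real.log y = Real.log 4 + 1 + (1 / (d - 1) * Real.log x + Real.log (1 / ε)) := by
      rw [hy, Real.log_mul (by positivity) (by positivity), Real.log_mul (by norm_num)
        (by positivity), Real.log_exp, div_eq_mul_one_div, Real.log_mul (by positivity)
        (by positivity), Real.log_rpow hx0]
    have : 1 / (d - 1) * Real.log x ≤ L / (d - 1) := by
      rw [one_div_mul_eq_div]
      gcongr
    linarith
  have hbase : ((K.choose w : ℕ) : ℝ) ≤ y ^ w := by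
    have h := choose_le_exp_mul_div_pow w hK (by positivity : 0 < W / 2) hw'
    have heq : Real.exp 1 * (2 * k) / (W / 2) = y := by
      rw [hy, ← hkW]
      field_simp
      norm_num
    rwa [heq] at h
  have hexp : (w : ℝ) * K ≤ 2 * (ε * d ^ 2 * x) := by
    calc (w : ℝ) * K ≤ W * (2 * k) := by gcongr
      _ = 2 * (ε * d ^ 2 * x) := by rw [← hWk]; ring
  have hlogy0 : 0 ≤ Real.log y := Real.log_nonneg hy1
  have hmain : (w : ℝ) * K * Real.log y ≤ 5 / 2 * d * n := by
    have hdx : d * x ≤ n / 5 := by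
      rw [hxdef, mul_div_assoc', div_le_div_iff₀ (by linarith) (by norm_num)]
      nlinarith
    have hLx : L * x = n := by
      rw [hxdef]
      field_simp
    have h₁ : ε * (4 + (1 / ε - 1)) ≤ 2 := by
      have : ε * (1 / ε) = 1 := by field_simp
      nlinarith
    have h₀ : 0 ≤ ε * (4 + (1 / ε - 1)) := by
      have : 0 < 1 / ε := by positivity
      exact mul_nonneg hε.le (by linarith)
    have h₂ : d / (d - 1) ≤ 2 := by
      rw [div_le_iff₀ hd1]
      linarith
    have h₃ : 2 * (ε * d ^ 2 * x) * (4 + (1 / ε - 1)) ≤ 4 / 5 * d * n := by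
      calc 2 * (ε * d ^ 2 * x) * (4 + (1 / ε - 1))
          = 2 * d * (d * x) * (ε * (4 + (1 / ε - 1))) := by ring
        _ ≤ 2 * d * (n / 5) * 2 := by gcongr
        _ = 4 / 5 * d * n := by ring
    have h₄ : 2 * (ε * d ^ 2 * x) * (L / (d - 1)) ≤ 4 / 3 * d * n := by
      calc 2 * (ε * d ^ 2 * x) * (L / (d - 1))
          = 2 * d * (L * x) * (ε * (d / (d - 1))) := by ring
        _ ≤ 2 * d * n * (1 / 3 * 2) := by
          rw [hLx]
          gcongr
        _ = 4 / 3 * d * n := by ring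
    have hdn : 0 < d * n := by positivity
    calc (w : ℝ) * K * Real.log y
        ≤ 2 * (ε * d ^ 2 * x) * (4 + (1 / ε - 1) + L / (d - 1)) := by gcongr
      _ ≤ 5 / 2 * d * n := by
        rw [mul_add]
        nlinarith
  calc ((K.choose w : ℕ) : ℝ) ^ K ≤ (y ^ w) ^ K := by gcongr
    _ = Real.exp ((w : ℝ) * K * Real.log y) := by
      rw [← pow_mul, ← Nat.cast_mul, ← Real.log_pow, Real.exp_log (by positivity)]
    _ ≤ Real.exp (5 / 2 * d * n) := Real.exp_le_exp.2 hmain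

theorem statement_13 :
    ∃ C₀ : ℝ, 0 < C₀ ∧ ∀ ε : ℝ, 0 < ε → ε ≤ 1 / 3 →
    ∃ n₀ : ℕ, ∀ n : ℕ, n₀ ≤ n → ∀ m : ℕ,
      (1 + ε) * n ≤ m → (m : ℝ) ≤ (n : ℝ) * Real.log n / 10 →
      (Nat.card {G : SimpleGraph (Fin n) // edgeCount G = m ∧
          (stww G : ℝ) ≤ ε * (2 * m / n) *
            ((n : ℝ) / Real.log n) ^ ((2 * (m : ℝ) / n - 2) / (2 * (2 * (m : ℝ) / n) - 2))} : ℝ)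
        ≤ (C₀ * ε * (n : ℝ) ^ 2 / m) ^ m := by
  refine ⟨4 * Real.exp 10, by positivity, fun ε hε hε' => ⟨1, fun n hn m hm hm' => ?_⟩⟩
  have hn1 : (1 : ℝ) ≤ n := by exact_mod_cast hn
  have hn0 : (0 : ℝ) < n := by linarith
  have hm0 : (0 : ℝ) < m := by nlinarith
  obtain ⟨L, hL⟩ : ∃ L, L = Real.log n := ⟨_, rfl⟩
  obtain ⟨d, hd⟩ : ∃ d : ℝ, d = 2 * m / n := ⟨_, rfl⟩
  obtain ⟨x, hx⟩ : ∃ x : ℝ, x = n / L := ⟨_, rfl⟩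
  obtain ⟨W, hW⟩ : ∃ W : ℝ, W = ε * d * x ^ ((d - 2) / (2 * d - 2)) := ⟨_, rfl⟩
  rw [← hL] at hm'
  have hdn : d * n = 2 * m := by
    rw [hd]
    field_simp
  have hd2 : 2 < d := by
    rw [hd, lt_div_iff₀ hn0]
    nlinarith
  have hdL : d ≤ L / 5 := by
    rw [hd, div_le_iff₀ hn0]
    linarith
  have hL10 : 10 ≤ L := by linarith
  have hx1 : 1 ≤ x := by
    rw [hx, le_div_iff₀ (by linarith), hL]
    linarith [Real.log_le_sub_one_of_pos hn0]
  have hx0 : 0 < x := by linarith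
  have hd1 : 0 < d - 1 := by linarith
  simp only [← hL, ← hd, ← hx, ← hW]
  rcases lt_or_ge W 1 with hW1 | hW1
  · have : IsEmpty {G : SimpleGraph (Fin n) // edgeCount G = m ∧ (stww G : ℝ) ≤ W} := by
      refine ⟨fun ⟨G, hG₁, hG₂⟩ => ?_⟩
      have h₀ : stww G = 0 := by
        have : (stww G : ℝ) < 1 := hG₂.trans_lt hW1
        exact Nat.lt_one_iff.1 (by exact_mod_cast this)
      rw [edgeCount_eq_zero_of_stww_eq_zero h₀] at hG₁
      simp [← hG₁] at hm0
    rw [Nat.card_eq_zero.2 (Or.inl this), Nat.cast_zero]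
    positivity
  have hW0 : 0 < W := by linarith
  obtain ⟨κ, hκ⟩ : ∃ κ : ℝ, κ = d / (2 * d - 2) := ⟨_, rfl⟩
  obtain ⟨k, hk⟩ : ∃ k : ℝ, k = d * x ^ κ := ⟨_, rfl⟩
  have h2d : 2 * d - 2 ≠ 0 := by linarith
  have hd1' : d - 1 ≠ 0 := hd1.ne'
  have hκω : (d - 2) / (2 * d - 2) = κ - 1 / (d - 1) := by
    rw [hκ, show 2 * d - 2 = 2 * (d - 1) by ring]
    field_simp
  have hκ1 : κ ≤ 1 := by
    rw [hκ, div_le_one (by linarith)]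
    linarith
  have hκ0 : 0 ≤ κ := by
    rw [hκ]
    exact div_nonneg (by linarith) (by linarith)
  have hsum : (d - 2) / (2 * d - 2) + κ = 1 := by
    rw [hκ, ← add_div, div_eq_one_iff_eq h2d]
    ring
  have hk2 : 2 ≤ k := by
    have := Real.one_le_rpow hx1 hκ0
    rw [hk]
    nlinarith
  have hk0 : 0 < k := by linarith
  have hLx : L * x = n := by
    rw [hx]
    field_simp
  have hkn : 5 * k ≤ n := by
    have h : x ^ κ ≤ x := by
      simpa using Real.rpow_le_rpow_of_exponent_le hx1 hκ1
    have : d * x ^ κ ≤ L / 5 * x := by gcongr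
    rw [hk]
    linarith
  have hWk : W * k = ε * d ^ 2 * x := by
    have : x ^ ((d - 2) / (2 * d - 2)) * x ^ κ = x := by
      rw [← Real.rpow_add hx0, hsum, Real.rpow_one]
    rw [hW, hk]
    linear_combination ε * d ^ 2 * this
  have hWk' : W = ε * k / x ^ (1 / (d - 1)) := by
    rw [hW, hk, hκω, Real.rpow_sub hx0]
    ring
  have hkW : k / W = x ^ (1 / (d - 1)) / ε := by
    rw [hWk']
    field_simp
  have hpow1 : 1 ≤ x ^ (1 / (d - 1)) := Real.one_le_rpow hx1 (by positivity)
  have hWlek : W ≤ k := by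
    rw [hWk', div_le_iff₀ (by linarith)]
    nlinarith
  set w := ⌊W⌋₊ with hw
  have hwW : (w : ℝ) ≤ W := Nat.floor_le hW0.le
  have hw1 : (1 : ℝ) ≤ w := by exact_mod_cast Nat.one_le_floor_iff W |>.2 hW1
  have hWw : W < w + 1 := Nat.lt_floor_add_one W
  set s := ⌊n / k⌋₊ with hs
  have hnk : 5 ≤ n / k := by
    rw [le_div_iff₀ hk0]
    exact hkn
  have hsle : (s : ℝ) ≤ n / k := Nat.floor_le (by positivity)
  have hslt : n / k < s + 1 := Nat.lt_floor_add_one _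
  have hs2 : 2 ≤ s := Nat.le_floor (by push_cast; linarith)
  have hs0 : (0 : ℝ) < s := by positivity
  set K := n / s + 1 with hK
  have hK2 : (K : ℝ) ≤ 2 * k := by
    have h : ((n / s : ℕ) : ℝ) ≤ n / s := Nat.cast_div_le
    have h' : (n : ℝ) / s ≤ 5 / 4 * k := by
      rw [div_le_iff₀ hs0]
      have : (n : ℝ) = n / k * k := by field_simp
      nlinarith
    rw [hK]
    push_cast
    linarith
  have hKk : k ≤ K := by
    have h : (n : ℝ) / s < K := by
      rw [div_lt_iff₀ hs0]
      exact_mod_cast (by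
        rw [hK, mul_comm]
        exact Nat.lt_mul_div_succ n (by omega) : n < K * s)
    have h' : k ≤ (n : ℝ) / s := by
      rw [le_div_iff₀ hs0, mul_comm]
      exact (le_div_iff₀ hk0).1 hsle
    linarith
  have hwK : w ≤ K := by exact_mod_cast hwW.trans (hWlek.trans hKk)
  have hcount := card_stww_le (V := Fin n) m w s hs2 (by simpa using hwK)
  simp only [Fintype.card_fin, ← hK] at hcount
  have hcard : Nat.card {G : SimpleGraph (Fin n) // edgeCount G = m ∧ (stww G : ℝ) ≤ W} =
      Nat.card {G : SimpleGraph (Fin n) // edgeCount G = m ∧ stww G ≤ w} := by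
    simp only [hw, Nat.le_floor_iff hW0.le]
  have hlab := labellings_bound (n := n) (κ := κ) (N := n) rfl hd2 hx0 (hk ▸ hK2)
  have hquot := quotients_bound hL10 hL hn1 hd2 hdL hε hε' (hx ▸ hx1) hk0 hW0 (hx ▸ hWk)
    (hx ▸ hkW) hK2 hwW (by linarith)
  have hedge : ((n * ((w + 1) * (2 * s))).choose m : ℝ) ≤
      (Real.exp 1 * (4 * ε * n ^ 2 / x ^ (1 / (d - 1))) / m) ^ m := by
    refine choose_le_exp_mul_div_pow m ?_ hm0 le_rfl
    push_cast
    calc (n : ℝ) * ((w + 1) * (2 * s)) ≤ n * ((2 * W) * (2 * (n / k))) := by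
          gcongr
          linarith
      _ = 4 * ε * n ^ 2 / x ^ (1 / (d - 1)) := by
          rw [hWk']
          field_simp
          norm_num
  have hcancel : x ^ (κ * n) = (x ^ (1 / (d - 1))) ^ m := by
    rw [← Real.rpow_natCast, ← Real.rpow_mul hx0.le]
    congr 1
    rw [hκ, div_mul_eq_mul_div, hdn]
    field_simp
  rw [hcard]
  calc (Nat.card {G : SimpleGraph (Fin n) // edgeCount G = m ∧ stww G ≤ w} : ℝ)
      ≤ (K : ℝ) ^ n * (K.choose w : ℝ) ^ K * ((n * ((w + 1) * (2 * s))).choose m : ℝ) := by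
        exact_mod_cast hcount
    _ ≤ (Real.exp (2 * d * n) * x ^ (κ * n)) * Real.exp (5 / 2 * d * n) *
        (Real.exp 1 * (4 * ε * n ^ 2 / x ^ (1 / (d - 1))) / m) ^ m := by gcongr
    _ = (4 * Real.exp 10 * ε * n ^ 2 / m) ^ m := by
        have h₁ : Real.exp (2 * d * n) = Real.exp 4 ^ m := by
          rw [← Real.exp_nat_mul]
          congr 1
          linear_combination 2 * hdn
        have h₂ : Real.exp (5 / 2 * d * n) = Real.exp 5 ^ m := by
          rw [← Real.exp_nat_mul]
          congr 1
          linear_combination 5 / 2 * hdn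
        have h₃ : Real.exp 10 = Real.exp 4 * Real.exp 5 * Real.exp 1 := by
          rw [← Real.exp_add, ← Real.exp_add]
          norm_num
        rw [h₁, h₂, h₃, hcancel, ← mul_pow, ← mul_pow, ← mul_pow]
        congr 1
        field_simp

end TwwPaper
end
end
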